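/- Let G be a simple graph on n vertices with m edges, and let k be a positive integer with τ(G) ≥ k. Then rmc_k(G) ≤ m − (k − 1)(n − 2). -/

import Mathlib

open SimpleGraph

/-- A walk is monochromatic with color `col` under the edge-coloring `c`. -/
def SimpleGraph.Walk.IsMonochromatic {V : Type*} {G : SimpleGraph V} (c : Sym2 V → ℕ)
    {u v : V} (W : G.Walk u v) (col : ℕ) : Prop :=
  ∀ e ∈ W.edges, c e = col

/-- `c` is a rainbow monochromatic `k`-edge-connection coloring of `G`:
every two distinct vertices are joined by `k` pairwise edge-disjoint monochromatic
paths with pairwise distinct colors. -/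
def SimpleGraph.IsRMCColoring {V : Type*} (G : SimpleGraph V) (k : ℕ) (c : Sym2 V → ℕ) : Prop :=
  ∀ u v : V, u ≠ v → ∃ (P : Fin k → G.Walk u v) (col : Fin k → ℕ),
    (∀ i, (P i).IsPath) ∧
    (∀ i, (P i).IsMonochromatic c (col i)) ∧
    (∀ i j, i ≠ j → ∀ e, e ∈ (P i).edges → e ∉ (P j).edges) ∧
    Function.Injective col

/-- The number of colors used by `c` on the edges of `G`. -/
noncomputable def SimpleGraph.colorsUsed {V : Type*} (G : SimpleGraph V) (c : Sym2 V → ℕ) : ℕ :=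
  (c '' G.edgeSet).ncard

/-- `rmc_k(G)`: the maximum number of colors in an RMC_k-coloring of `G` (0 if none exists). -/
noncomputable def SimpleGraph.rmc {V : Type*} (G : SimpleGraph V) (k : ℕ) : ℕ :=
  sSup {t | ∃ c : Sym2 V → ℕ, G.IsRMCColoring k c ∧ G.colorsUsed c = t}

/-- `τ(G) ≥ k`: `G` has `k` pairwise edge-disjoint spanning trees
(Nash-Williams–Tutte). -/
def SimpleGraph.TauGE {V : Type*} (G : SimpleGraph V) (k : ℕ) : Prop :=
  ∃ T : Fin k → SimpleGraph V, (∀ i, T i ≤ G) ∧ (∀ i, (T i).IsTree) ∧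
    ∀ i j, i ≠ j → Disjoint (T i).edgeSet (T j).edgeSet

namespace SimpleGraph

variable {V : Type*}

/-- A vertex with a nontrivial walk to `r` has a neighbour strictly closer to `r`. -/
lemma Reachable.exists_adj_dist_lt {G : SimpleGraph V} {v r : V} (h : G.Reachable v r)
    (hne : v ≠ r) : ∃ w, G.Adj v w ∧ G.Reachable w r ∧ G.dist w r < G.dist v r := by
  obtain ⟨p, hp⟩ := h.exists_walk_length_eq_dist
  cases p with
  | nil => exact absurd rfl hne
  | cons hadj q =>
    refine ⟨_, hadj, ⟨q⟩, ?_⟩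
    have := dist_le q
    simp only [Walk.length_cons] at hp
    omega

/-- A chosen representative of the connected component of a vertex. -/
noncomputable def componentRep (G : SimpleGraph V) (v : V) : V :=
  (G.connectedComponentMk v).out

lemma reachable_componentRep (G : SimpleGraph V) (v : V) : G.Reachable v (G.componentRep v) :=
  ConnectedComponent.exact (Quot.out_eq (G.connectedComponentMk v)).symm

lemma Reachable.componentRep_eq {G : SimpleGraph V} {u v : V} (h : G.Reachable u v) :
    G.componentRep u = G.componentRep v :=
  congrArg Quot.out (ConnectedComponent.sound h)

lemma card_ne_componentRep_le [Finite V] (G : SimpleGraph V) :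
    Nat.card {v // v ≠ G.componentRep v} ≤ G.edgeSet.ncard := by
  choose w hadj hreach hlt using fun v : {v // v ≠ G.componentRep v} =>
    (G.reachable_componentRep v.1).exists_adj_dist_lt v.2
  let f : {v // v ≠ G.componentRep v} → G.edgeSet := fun v => ⟨s(v.1, w v), hadj v⟩
  rw [← Nat.card_coe_set_eq]
  refine Nat.card_le_card_of_injective f fun a b hab => ?_
  rcases Sym2.eq_iff.mp (congrArg Subtype.val hab) with ⟨h, -⟩ | ⟨h₁, h₂⟩
  · exact Subtype.ext h
  · have ha := hlt a
    have hb := hlt b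
    have hr := (hadj a).reachable.componentRep_eq
    rw [h₂] at ha hr
    rw [← h₁, ← hr] at hb
    omega

open scoped Classical in
/-- The ordered pairs of distinct vertices joined by a walk. -/
noncomputable def reachablePairs [Fintype V] (G : SimpleGraph V) : Finset (V × V) :=
  {p ∈ Finset.univ.offDiag | G.Reachable p.1 p.2}

lemma card_reachablePairs_le_card [Fintype V] (G : SimpleGraph V) :
    G.reachablePairs.card ≤ Fintype.card V * (Fintype.card V - 1) := by
  classical
  refine (Finset.card_le_card (Finset.filter_subset _ _)).trans ?_
  rw [Finset.offDiag_card, Finset.card_univ, Nat.mul_sub_one]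

lemma card_reachablePairs_le_edges [Fintype V] (G : SimpleGraph V) :
    G.reachablePairs.card ≤ G.edgeSet.ncard * (G.edgeSet.ncard + 1) := by
  classical
  let N := {v // v ≠ G.componentRep v}
  let g : V → Option N := fun v => if h : v ≠ G.componentRep v then some ⟨v, h⟩ else none
  have key : ∀ x y, g x = g y → x = y ∨ (x = G.componentRep x ∧ y = G.componentRep y) := by
    intro x y hxy
    by_cases hx : x = G.componentRep x <;> by_cases hy : y = G.componentRep y
    · exact Or.inr ⟨hx, hy⟩
    · simp only [g, dif_neg (not_not.mpr hx), dif_pos hy, reduceCtorEq] at hxy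
    · simp only [g, dif_pos hx, dif_neg (not_not.mpr hy), reduceCtorEq] at hxy
    · simp only [g, dif_pos hx, dif_pos hy, Option.some.injEq] at hxy
      exact Or.inl (congrArg Subtype.val hxy)
  have hg : ∀ u v, g u = g v → G.Reachable u v → u = v := by
    intro u v h hr
    rcases key u v h with h | ⟨hu, hv⟩
    · exact h
    · exact hu.trans (hr.componentRep_eq.trans hv.symm)
  have hcard : G.reachablePairs.card ≤ (Finset.univ : Finset (Option N)).offDiag.card := by
    refine Finset.card_le_card_of_injOn (fun p => (g p.1, g p.2)) ?_ ?_
    · intro p hp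
      simp only [reachablePairs, Finset.coe_filter, Finset.mem_offDiag, Finset.mem_univ,
        true_and, Set.mem_ofPred_eq] at hp
      simpa using fun h => hp.1 (hg _ _ h hp.2)
    · rintro ⟨u, v⟩ hp ⟨u', v'⟩ hp' h
      simp only [reachablePairs, Finset.coe_filter, Finset.mem_offDiag, Finset.mem_univ,
        true_and, Set.mem_ofPred_eq] at hp hp'
      simp only [Prod.mk.injEq] at h
      have h₁ := hp.2.componentRep_eq
      have h₂ := hp'.2.componentRep_eq
      have k₁ := key _ _ h.1
      have k₂ := key _ _ h.2
      grind
  rw [Finset.offDiag_card, Finset.card_univ, Fintype.card_option, ← Nat.card_eq_fintype_card]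
    at hcard
  have hN : Nat.card N ≤ G.edgeSet.ncard := G.card_ne_componentRep_le
  calc G.reachablePairs.card ≤ Nat.card N * (Nat.card N + 1) := by
        refine hcard.trans (le_of_eq ?_)
        rw [Nat.sub_eq_iff_eq_add (Nat.le_mul_self _)]
        ring
    _ ≤ _ := by gcongr

lemma card_reachablePairs_mul_le [Fintype V] (G : SimpleGraph V) (hV : 3 ≤ Fintype.card V)
    (hE : 2 ≤ G.edgeSet.ncard) :
    G.reachablePairs.card * (Fintype.card V - 2) ≤
      (G.edgeSet.ncard - 1) * (Fintype.card V * (Fintype.card V - 1)) := by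
  have h₁ := G.card_reachablePairs_le_card
  have h₂ := G.card_reachablePairs_le_edges
  generalize G.reachablePairs.card = r at *
  generalize G.edgeSet.ncard = q at *
  obtain ⟨n, hn⟩ := Nat.exists_eq_add_of_le hV
  rw [hn] at h₁ ⊢
  obtain ⟨q, rfl⟩ := Nat.exists_eq_add_of_le hE
  rw [show 3 + n - 1 = n + 2 by omega] at *
  rw [show 3 + n - 2 = n + 1 by omega, show 2 + q - 1 = q + 1 by omega]
  rcases le_or_gt n q with h | h
  · calc r * (n + 1) ≤ ((3 + n) * (n + 2)) * (n + 1) := by gcongr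
      _ ≤ ((3 + n) * (n + 2)) * (q + 1) := by gcongr
      _ = _ := by ring
  · obtain ⟨d, rfl⟩ := Nat.exists_eq_add_of_lt h
    refine (Nat.mul_le_mul_right _ h₂).trans ?_
    zify
    nlinarith [mul_nonneg (Int.natCast_nonneg d) (Int.natCast_nonneg q),
      mul_nonneg (Int.natCast_nonneg d) (Int.natCast_nonneg d),
      mul_nonneg (mul_nonneg (Int.natCast_nonneg d) (Int.natCast_nonneg d)) (Int.natCast_nonneg q),
      mul_nonneg (mul_nonneg (Int.natCast_nonneg d) (Int.natCast_nonneg q)) (Int.natCast_nonneg q),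
      mul_nonneg (Int.natCast_nonneg q) (Int.natCast_nonneg q)]

/-- The subgraph formed by the edges of color `a`. -/
def colorGraph (G : SimpleGraph V) (c : Sym2 V → ℕ) (a : ℕ) : SimpleGraph V :=
  fromEdgeSet {e ∈ G.edgeSet | c e = a}

lemma edgeSet_colorGraph (G : SimpleGraph V) (c : Sym2 V → ℕ) (a : ℕ) :
    (G.colorGraph c a).edgeSet = {e ∈ G.edgeSet | c e = a} := by
  rw [colorGraph, edgeSet_fromEdgeSet]
  ext e
  simpa using fun he _ => G.not_isDiag_of_mem_edgeSet he

lemma Walk.IsMonochromatic.mem_edgeSet_colorGraph {G : SimpleGraph V} {c : Sym2 V → ℕ} {a : ℕ}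
    {u v : V} {p : G.Walk u v} (h : p.IsMonochromatic c a) :
    ∀ e ∈ p.edges, e ∈ (G.colorGraph c a).edgeSet := by
  intro e he
  rw [edgeSet_colorGraph]
  exact ⟨p.edges_subset_edgeSet he, h e he⟩

lemma Walk.IsMonochromatic.color_eq_of_ncard_le_one [Finite V] {G : SimpleGraph V}
    {c : Sym2 V → ℕ} {a : ℕ} {u v : V} {p : G.Walk u v} (h : p.IsMonochromatic c a)
    (hp : p.IsPath) (huv : u ≠ v) (hE : (G.colorGraph c a).edgeSet.ncard ≤ 1) :
    a = c s(u, v) := by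
  cases p with
  | nil => exact absurd rfl huv
  | cons hadj q =>
    cases q with
    | nil => exact (h _ (by simp)).symm
    | cons hadj' q =>
      have heq := (Set.ncard_le_one (Set.toFinite _)).mp hE _
        (h.mem_edgeSet_colorGraph _ List.mem_cons_self) _
        (h.mem_edgeSet_colorGraph _ (List.mem_cons_of_mem _ List.mem_cons_self))
      have hnd := hp.isTrail.edges_nodup
      simp only [Walk.edges_cons, List.nodup_cons, List.mem_cons] at hnd
      exact absurd (Or.inl heq) hnd.1

open scoped Classical in
/-- The colors used on at least two edges of `G`. -/
noncomputable def repeatedColors [Fintype V] (G : SimpleGraph V) (c : Sym2 V → ℕ) : Finset ℕ :=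
  {a ∈ G.edgeFinset.image c | 2 ≤ (G.colorGraph c a).edgeSet.ncard}

open scoped Classical in
lemma IsRMCColoring.le_card_repeatedColors [Fintype V] {G : SimpleGraph V} {k : ℕ}
    {c : Sym2 V → ℕ} (hc : G.IsRMCColoring k c) {u v : V} (huv : u ≠ v) :
    k - 1 ≤ {a ∈ G.repeatedColors c | (G.colorGraph c a).Reachable u v}.card := by
  obtain ⟨P, col, hpath, hmono, -, hinj⟩ := hc u v huv
  have hsub : (Finset.univ.image col).erase (c s(u, v)) ⊆
      {a ∈ G.repeatedColors c | (G.colorGraph c a).Reachable u v} := by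
    intro a ha
    simp only [Finset.mem_erase, Finset.mem_image, Finset.mem_univ, true_and] at ha
    obtain ⟨hne, i, rfl⟩ := ha
    simp only [repeatedColors, Finset.mem_filter, Finset.mem_image, mem_edgeFinset]
    refine ⟨⟨?_, ?_⟩, ⟨(P i).transfer _ (hmono i).mem_edgeSet_colorGraph⟩⟩
    · have hm := hmono i
      cases hP : P i with
      | nil => exact absurd rfl huv
      | cons hadj q =>
        rw [hP] at hm
        exact ⟨_, G.mem_edgeSet.mpr hadj, hm _ List.mem_cons_self⟩
    · by_contra! hlt
      exact hne ((hmono i).color_eq_of_ncard_le_one (hpath i) huv (by omega))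
  calc k - 1 = (Finset.univ.image col).card - 1 := by
        rw [Finset.card_image_of_injective _ hinj, Finset.card_univ, Fintype.card_fin]
    _ ≤ _ := Finset.pred_card_le_card_erase
    _ ≤ _ := Finset.card_le_card hsub

lemma IsRMCColoring.mul_le_sum_card_reachablePairs [Fintype V] {G : SimpleGraph V} {k : ℕ}
    {c : Sym2 V → ℕ} (hc : G.IsRMCColoring k c) :
    (k - 1) * (Fintype.card V * (Fintype.card V - 1)) ≤
      ∑ a ∈ G.repeatedColors c, (G.colorGraph c a).reachablePairs.card := by
  classical
  calc (k - 1) * (Fintype.card V * (Fintype.card V - 1))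
      = ∑ _p ∈ (Finset.univ : Finset V).offDiag, (k - 1) := by
        rw [Finset.sum_const, Finset.offDiag_card, Finset.card_univ, Nat.mul_sub_one,
          smul_eq_mul, mul_comm]
    _ ≤ ∑ p ∈ (Finset.univ : Finset V).offDiag,
          {a ∈ G.repeatedColors c | (G.colorGraph c a).Reachable p.1 p.2}.card :=
        Finset.sum_le_sum fun p hp =>
          hc.le_card_repeatedColors (Finset.mem_offDiag.mp hp).2.2
    _ = _ := Finset.sum_card_bipartiteAbove_eq_sum_card_bipartiteBelow
          (fun (p : V × V) a => (G.colorGraph c a).Reachable p.1 p.2)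

lemma colorsUsed_add_sum_repeatedColors [Fintype V] (G : SimpleGraph V) (c : Sym2 V → ℕ) :
    G.colorsUsed c + ∑ a ∈ G.repeatedColors c, ((G.colorGraph c a).edgeSet.ncard - 1) =
      G.edgeSet.ncard := by
  classical
  have hq : ∀ a, (G.colorGraph c a).edgeSet.ncard = {e ∈ G.edgeFinset | c e = a}.card := by
    intro a
    rw [edgeSet_colorGraph, ← Set.ncard_coe_finset]
    simp
  have hC : G.colorsUsed c = (G.edgeFinset.image c).card := by
    rw [colorsUsed, ← Set.ncard_coe_finset]
    simp
  have hE : G.edgeSet.ncard = G.edgeFinset.card := by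
    rw [← Set.ncard_coe_finset]
    simp
  have hsum : ∑ a ∈ G.repeatedColors c, ((G.colorGraph c a).edgeSet.ncard - 1) =
      ∑ a ∈ G.edgeFinset.image c, ((G.colorGraph c a).edgeSet.ncard - 1) := by
    rw [repeatedColors]
    refine Finset.sum_filter_of_ne fun a _ ha => ?_
    omega
  rw [hsum, hC, hE, Finset.card_eq_sum_ones, ← Finset.sum_add_distrib,
    Finset.card_eq_sum_card_image c G.edgeFinset]
  refine Finset.sum_congr rfl fun a ha => ?_
  rw [hq]
  have : 0 < {e ∈ G.edgeFinset | c e = a}.card := by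
    obtain ⟨e, he, rfl⟩ := Finset.mem_image.mp ha
    exact Finset.card_pos.mpr ⟨e, Finset.mem_filter.mpr ⟨he, rfl⟩⟩
  omega

lemma IsRMCColoring.colorsUsed_add_le [Fintype V] {G : SimpleGraph V} {k : ℕ}
    {c : Sym2 V → ℕ} (hc : G.IsRMCColoring k c) :
    G.colorsUsed c + (k - 1) * (Fintype.card V - 2) ≤ G.edgeSet.ncard := by
  rw [← G.colorsUsed_add_sum_repeatedColors c]
  refine Nat.add_le_add_left ?_ _
  rcases lt_or_ge (Fintype.card V) 3 with hV | hV
  · simp [show Fintype.card V - 2 = 0 by omega]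
  have hpos : 0 < Fintype.card V * (Fintype.card V - 1) :=
    Nat.mul_pos (by omega) (by omega)
  refine Nat.le_of_mul_le_mul_right ?_ hpos
  calc (k - 1) * (Fintype.card V - 2) * (Fintype.card V * (Fintype.card V - 1))
      = (k - 1) * (Fintype.card V * (Fintype.card V - 1)) * (Fintype.card V - 2) :=
        mul_right_comm _ _ _
    _ ≤ (∑ a ∈ G.repeatedColors c, (G.colorGraph c a).reachablePairs.card) *
          (Fintype.card V - 2) := Nat.mul_le_mul_right _ hc.mul_le_sum_card_reachablePairs
    _ ≤ _ := by
        rw [Finset.sum_mul, Finset.sum_mul]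
        refine Finset.sum_le_sum fun a ha => ?_
        exact card_reachablePairs_mul_le _ hV (Finset.mem_filter.mp ha).2

end SimpleGraph

/-- If `τ(G) ≥ k` then `rmc_k(G) ≤ m - (k-1)(n-2)`. -/
theorem rmc_le_of_tauGE {V : Type*} [Fintype V] (G : SimpleGraph V) (k : ℕ)
    (hk : 1 ≤ k) (htau : G.TauGE k) :
    G.rmc k ≤ G.edgeSet.ncard - (k - 1) * (Fintype.card V - 2) := by
  refine csSup_le' ?_
  rintro _ ⟨c, hc, rfl⟩
  exact Nat.le_sub_of_add_le hc.colorsUsed_add_le
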